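/- arXiv:2309.02846 — 2 statements merged into one kernel-verified Lean document; each statement's English description precedes it below -/
import Mathlib

section
/- Let X be a separable real Banach space which is isometrically isomorphic to the dual of some real normed space Y, let μ be a Borel probability measure on X, and let C ⊆ X be a bounded, convex set with nonempty (norm) interior that is closed in the weak* topology of X = Y*. Then there exists x₀ ∈ X such that μ(x₀ + C) ≥ μ(x + C) for all x ∈ X. -/
open MeasureTheory

open scoped Pointwise

/-- A finite Borel measure on a Polish space is tight on open sets: if the complement of an open
set has measure less than `a`, then so has the complement of some compact subset of it. -/
theorem IsOpen.exists_isCompact_subset_measure_compl_lt {X : Type*} [TopologicalSpace X]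
    [PolishSpace X] [MeasurableSpace X] [BorelSpace X] (μ : Measure X)
    [IsFiniteMeasure μ] {U : Set X} (hU : IsOpen U) {a : ENNReal} (ha : μ Uᶜ < a) :
    ∃ K ⊆ U, IsCompact K ∧ μ Kᶜ < a := by
  obtain ⟨K, hKU, hK, hlt⟩ := hU.measurableSet.exists_isCompact_sdiff_lt (μ := μ)
    (measure_ne_top μ U) (tsub_pos_of_lt ha).ne'
  refine ⟨K, hKU, hK, ?_⟩
  have hsplit : Kᶜ ⊆ Uᶜ ∪ U \ K := fun x hx => by
    by_cases h : x ∈ U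
    · exact Or.inr ⟨h, hx⟩
    · exact Or.inl h
  calc μ Kᶜ ≤ μ Uᶜ + μ (U \ K) := (measure_mono hsplit).trans (measure_union_le _ _)
    _ < μ Uᶜ + (a - μ Uᶜ) := ENNReal.add_lt_add_left (measure_ne_top μ _) hlt
    _ = a := add_tsub_cancel_of_le ha.le

/-- **Existence of most likely translates of a convex set** on a separable Banach space
which is (isometrically isomorphic to) the dual of a normed space. -/
theorem most_likely_translate_exists_of_dual
    {X : Type*} [NormedAddCommGroup X] [NormedSpace ℝ X] [CompleteSpace X]
    [TopologicalSpace.SeparableSpace X]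
    {Y : Type*} [NormedAddCommGroup Y] [NormedSpace ℝ Y]
    (e : X ≃ₗᵢ[ℝ] StrongDual ℝ Y)
    [MeasurableSpace X] [BorelSpace X]
    (μ : Measure X) [IsProbabilityMeasure μ]
    (C : Set X) (hCbdd : Bornology.IsBounded C) (hCconv : Convex ℝ C)
    (hCint : (interior C).Nonempty)
    (hCclosed : IsClosed (StrongDual.toWeakDual '' (e '' C))) :
    ∃ x₀ : X, ∀ x : X, μ ((fun c => x + c) '' C) ≤ μ ((fun c => x₀ + c) '' C) := by
  let T : X ≃ₗ[ℝ] WeakDual ℝ Y := e.toLinearEquiv.trans StrongDual.toWeakDual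
  have hT : Continuous T := NormedSpace.Dual.toWeakDual_continuous.comp e.continuous
  rw [← Set.image_comp] at hCclosed
  change IsClosed (T '' C) at hCclosed
  have hTC : IsCompact (T '' C) :=
    WeakDual.isCompact_of_bounded_of_closed (e.lipschitz.isBounded_image hCbdd) hCclosed
  have hC : IsClosed C := by
    rw [← T.injective.preimage_image C]
    exact hCclosed.preimage hT
  let f : WeakDual ℝ Y → ENNReal := fun w => μ ((fun c => T.symm w + c) '' C)
  have hmiss : ∀ (K : Set X) (w : WeakDual ℝ Y), w ∉ T '' K - T '' C → f w ≤ μ Kᶜ := by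
    refine fun K w hw => measure_mono ?_
    rintro _ ⟨c, hc, rfl⟩ hK
    exact hw ⟨_, ⟨_, hK, rfl⟩, _, ⟨c, hc, rfl⟩, by simp⟩
  have hcomp : ∀ K : Set X, IsCompact K → IsCompact (T '' K - T '' C) := fun K hK => by
    simpa only [sub_eq_add_neg] using (hK.image hT).add hTC.neg
  have husc : UpperSemicontinuous f := by
    intro w a ha
    have hcl : IsClosed ((fun c => T.symm w + c) '' C) :=
      (Homeomorph.addLeft (T.symm w)).isClosedMap _ hC
    obtain ⟨K, hKU, hK, hlt⟩ :=
      hcl.isOpen_compl.exists_isCompact_subset_measure_compl_lt μ (a := a) (by simpa [f] using ha)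
    have hw : w ∉ T '' K - T '' C := by
      rintro ⟨_, ⟨k, hk, rfl⟩, _, ⟨c, hc, rfl⟩, rfl⟩
      exact hKU hk ⟨c, hc, by simp⟩
    filter_upwards [(hcomp K hK).isClosed.isOpen_compl.mem_nhds hw] with v hv
    exact (hmiss K v hv).trans_lt hlt
  suffices ∃ w₀, ∀ w, f w ≤ f w₀ by
    obtain ⟨w₀, hw₀⟩ := this
    exact ⟨T.symm w₀, fun x => by simpa [f] using hw₀ (T x)⟩
  by_cases hzero : ∀ w, f w = 0
  · exact ⟨0, fun w => by simp [hzero]⟩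
  push Not at hzero
  obtain ⟨w₁, hw₁⟩ := hzero
  obtain ⟨K, -, hK, hlt⟩ := isOpen_univ.exists_isCompact_subset_measure_compl_lt μ
    (a := f w₁) (by simpa using pos_iff_ne_zero.2 hw₁)
  have hout : ∀ w, w ∉ T '' K - T '' C → f w < f w₁ := fun w hw => (hmiss K w hw).trans_lt hlt
  have hmem : w₁ ∈ T '' K - T '' C := by_contra fun h => (hout w₁ h).false
  obtain ⟨w₀, -, hmax⟩ := (husc.upperSemicontinuousOn _).exists_isMaxOn ⟨w₁, hmem⟩ (hcomp K hK)
  refine ⟨w₀, fun w => ?_⟩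
  by_cases hw : w ∈ T '' K - T '' C
  · exact hmax hw
  · exact (hout w hw).le.trans (hmax hmem)
end

section
/- Let X = Y* be the dual of a real normed space Y, let C ⊆ X be a bounded, convex, weak*-closed set, let (xₙ) be a sequence in X converging weak* to x₀ ∈ X, and let (νₙ) be finite Borel measures on X with νₙ(X \ (xₙ + C)) = 0 for all n, converging weakly (in duality with bounded norm-continuous functions) to a finite Borel measure ν. Then ν(X \ (x₀ + C)) = 0, i.e., ν is supported on x₀ + C. -/
open MeasureTheory Filter

/-- If finite measures converging weakly to `ν₀` are eventually supported on a nonempty set `U`,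
then `ν₀`-almost every point lies in the closure of `U`. -/
lemma ae_mem_closure_of_tendsto_integral {X : Type*} [PseudoMetricSpace X] [MeasurableSpace X]
    [BorelSpace X] {ν : ℕ → Measure X} {ν₀ : Measure X} [IsFiniteMeasure ν₀]
    (hconv : ∀ f : BoundedContinuousFunction X ℝ,
      Tendsto (fun n => ∫ w, f w ∂(ν n)) atTop (nhds (∫ w, f w ∂ν₀)))
    {U : Set X} (hU : U.Nonempty) (hsupp : ∀ᶠ n in atTop, ν n Uᶜ = 0) :
    ∀ᵐ w ∂ν₀, w ∈ closure U := by
  let f : BoundedContinuousFunction X ℝ :=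
    BoundedContinuousFunction.ofNormedAddCommGroup (fun w => min 1 (Metric.infDist w U))
      (continuous_const.min (Metric.continuous_infDist_pt U)) 1 (fun w => by
        rw [Real.norm_of_nonneg (le_min zero_le_one Metric.infDist_nonneg)]
        exact min_le_left _ _)
  have hf : ∀ w, f w = min 1 (Metric.infDist w U) := fun _ => rfl
  have hzero : ∀ᶠ n in atTop, ∫ w, f w ∂(ν n) = 0 := by
    filter_upwards [hsupp] with n hn
    refine integral_eq_zero_of_ae ?_
    have hmem : ∀ᵐ w ∂(ν n), w ∈ U := hn
    filter_upwards [hmem] with w hw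
    simp [hf, Metric.infDist_zero_of_mem hw]
  have hint : ∫ w, f w ∂ν₀ = 0 :=
    tendsto_nhds_unique (hconv f) (tendsto_const_nhds.congr' (hzero.mono fun _ h => h.symm))
  have hnonneg : 0 ≤ fun w => f w := fun w => le_min zero_le_one Metric.infDist_nonneg
  rw [integral_eq_zero_iff_of_nonneg hnonneg (f.integrable ν₀)] at hint
  filter_upwards [hint] with w hw
  rw [Metric.mem_closure_iff_infDist_zero hU]
  have hw' : min 1 (Metric.infDist w U) = 0 := hw
  rcases min_choice 1 (Metric.infDist w U) with h | h <;> linarith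

/-- If `w` is a norm-limit point of `⋃ n ≥ m, xₙ + C` for every `m`, where `C` is weak*-closed
and `xₙ → x₀` weak*, then `w ∈ x₀ + C`. -/
lemma mem_translate_of_forall_mem_closure {Y : Type*} [NormedAddCommGroup Y] [NormedSpace ℝ Y]
    {C : Set (StrongDual ℝ Y)} (hCclosed : IsClosed (StrongDual.toWeakDual '' C))
    {x : ℕ → StrongDual ℝ Y} {x₀ : StrongDual ℝ Y}
    (hx : ∀ y : Y, Tendsto (fun n => x n y) atTop (nhds (x₀ y))) {w : StrongDual ℝ Y}
    (hw : ∀ m : ℕ, w ∈ closure (⋃ n ≥ m, (fun c => x n + c) '' C)) :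
    w ∈ (fun c => x₀ + c) '' C := by
  have hclose : ∀ m : ℕ, ∃ n ≥ m, ∃ c ∈ C, dist w (x n + c) < 1 / ((m : ℝ) + 1) := by
    intro m
    obtain ⟨b, hb, hdist⟩ := Metric.mem_closure_iff.1 (hw m) _ (Nat.one_div_pos_of_nat (n := m))
    simp only [Set.mem_iUnion, Set.mem_image] at hb
    obtain ⟨n, hn, c, hc, rfl⟩ := hb
    exact ⟨n, hn, c, hc, hdist⟩
  choose n hn c hc hdist using hclose
  have hn_tendsto : Tendsto n atTop atTop := tendsto_atTop_mono hn tendsto_id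
  have hnorm : Tendsto (fun m => x (n m) + c m) atTop (nhds w) := by
    rw [tendsto_iff_dist_tendsto_zero]
    refine squeeze_zero (fun _ => dist_nonneg) (fun m => ?_)
      (tendsto_one_div_add_atTop_nhds_zero_nat (𝕜 := ℝ))
    rw [dist_comm]
    exact (hdist m).le
  have hweak : Tendsto (fun m => StrongDual.toWeakDual (c m)) atTop
      (nhds (StrongDual.toWeakDual (w - x₀))) := by
    rw [tendsto_iff_forall_eval_tendsto_topDualPairing]
    intro y
    have happly : Tendsto (fun m => (x (n m) + c m) y) atTop (nhds (w y)) :=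
      ((ContinuousLinearMap.apply ℝ ℝ y).continuous.tendsto w).comp hnorm
    change Tendsto (fun m => c m y) atTop (nhds (w y - x₀ y))
    simpa using happly.sub ((hx y).comp hn_tendsto)
  obtain ⟨c₀, hc₀, heq⟩ :=
    hCclosed.mem_of_tendsto hweak (Eventually.of_forall fun m => Set.mem_image_of_mem _ (hc m))
  refine ⟨c₀, hc₀, ?_⟩
  rw [StrongDual.toWeakDual.injective heq]
  exact add_sub_cancel x₀ w

/-- If finite Borel measures `νₙ` on a dual space `X = Y*`, each supported on a translate
`xₙ + C` of a bounded convex weak*-closed set `C`, converge weakly to `ν`, and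
`xₙ → x₀` in the weak* topology, then `ν` is supported on `x₀ + C`. -/
theorem weak_limit_supported_on_translate
    {Y : Type*} [NormedAddCommGroup Y] [NormedSpace ℝ Y]
    [MeasurableSpace (StrongDual ℝ Y)] [BorelSpace (StrongDual ℝ Y)]
    (C : Set (StrongDual ℝ Y)) (hCbdd : Bornology.IsBounded C)
    (hCconv : Convex ℝ C)
    (hCclosed : IsClosed (StrongDual.toWeakDual '' C))
    (x : ℕ → StrongDual ℝ Y) (x₀ : StrongDual ℝ Y)
    (hx : ∀ y : Y, Tendsto (fun n => x n y) atTop (nhds (x₀ y)))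
    (ν : ℕ → Measure (StrongDual ℝ Y)) (hνfin : ∀ n, IsFiniteMeasure (ν n))
    (ν₀ : Measure (StrongDual ℝ Y)) [IsFiniteMeasure ν₀]
    (hsupp : ∀ n, ν n ((fun c => x n + c) '' C)ᶜ = 0)
    (hconv : ∀ f : BoundedContinuousFunction (StrongDual ℝ Y) ℝ,
      Tendsto (fun n => ∫ w, f w ∂(ν n)) atTop (nhds (∫ w, f w ∂ν₀))) :
    ν₀ ((fun c => x₀ + c) '' C)ᶜ = 0 := by
  rcases C.eq_empty_or_nonempty with rfl | hC
  · have hν : ∀ n, ν n = 0 := by simpa using hsupp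
    have hone := hconv (BoundedContinuousFunction.const _ 1)
    simp only [hν, tendsto_const_nhds_iff,
      BoundedContinuousFunction.const_apply, integral_const, smul_eq_mul, mul_one] at hone
    simpa [Measure.real, ENNReal.toReal_eq_zero_iff] using hone.symm
  · have hclosure : ∀ m : ℕ, ∀ᵐ w ∂ν₀, w ∈ closure (⋃ n ≥ m, (fun c => x n + c) '' C) := by
      intro m
      refine ae_mem_closure_of_tendsto_integral hconv ?_ ?_
      · obtain ⟨c, hc⟩ := hC
        exact ⟨x m + c, Set.mem_biUnion (le_refl m) (Set.mem_image_of_mem _ hc)⟩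
      · filter_upwards [eventually_ge_atTop m] with n hn
        refine measure_mono_null (Set.compl_subset_compl.2 ?_) (hsupp n)
        exact Set.subset_biUnion_of_mem (u := fun n => (fun c => x n + c) '' C) hn
    change ∀ᵐ w ∂ν₀, w ∈ (fun c => x₀ + c) '' C
    filter_upwards [ae_all_iff.2 hclosure] with w hw
    exact mem_translate_of_forall_mem_closure hCclosed hx hw
end
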